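/- ('Quasi'-orthogonality for Carleson families) Let σ be a positive locally finite Borel measure on ℝⁿ, let 𝒟 be a dyadic grid, and let 𝓕 ⊆ 𝒟 be a σ-Carleson collection with constant C₀, i.e. Σ_{F′ ∈ 𝓕 : F′ ⊆ F} σ(F′) ≤ C₀ σ(F) for every F ∈ 𝓕. Then there is a constant C₀′ depending only on C₀ such that for every family of nonnegative numbers (α_F)_{F∈𝓕}: ∫_{ℝⁿ} ( Σ_{F∈𝓕} α_F 1_F )² dσ ≤ C₀′ Σ_{F∈𝓕} α_F² σ(F). -/

import Mathlib

open MeasureTheory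
open scoped ENNReal NNReal

noncomputable section

/-- An axis-parallel half-open cube in `ℝⁿ`, given by its corner `a` and side length `l`. -/
structure QCube (n : ℕ) where
  a : Fin n → ℝ
  l : ℝ

/-- The half-open cube as a subset of `ℝⁿ`. -/
def QCube.pts {n : ℕ} (Q : QCube n) : Set (EuclideanSpace ℝ (Fin n)) :=
  {x | ∀ i, Q.a i ≤ x i ∧ x i < Q.a i + Q.l}

/-- The dyadic grid on `ℝⁿ` obtained by translating the standard grid by `t`. -/
def dyadicGrid {n : ℕ} (t : Fin n → ℝ) : Set (QCube n) :=
  {Q | ∃ (k : ℤ) (m : Fin n → ℤ),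
    Q = ⟨fun i => t i + (2:ℝ) ^ (-k) * (m i : ℝ), (2:ℝ) ^ (-k)⟩}

/-- `𝓕` is a `σ`-Carleson collection with constant `C₀`:
`Σ_{F'∈𝓕, F'⊆F} σ(F') ≤ C₀ σ(F)` for all `F ∈ 𝓕`. -/
def IsCarleson {n : ℕ} (σ : Measure (EuclideanSpace ℝ (Fin n))) (C₀ : ℝ)
    (F𝓕 : Set (QCube n)) : Prop :=
  ∀ F ∈ F𝓕, (∑' G : {G : QCube n // G ∈ F𝓕 ∧ G.pts ⊆ F.pts}, σ (G : QCube n).pts)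
    ≤ ENNReal.ofReal C₀ * σ F.pts

open Classical in
/-- Square of a finite sum over a chain. -/
lemma sq_sum_chain {ι X : Type*} (J : Finset ι) (P : ι → Set X) (a : ι → ℝ)
    (ha : ∀ i, 0 ≤ a i) (hJ : ∀ i ∈ J, ∀ j ∈ J, P i ⊆ P j ∨ P j ⊆ P i) :
    (∑ i ∈ J, a i) ^ 2 ≤ 2 * ∑ i ∈ J, a i * ∑ j ∈ J, (if P i ⊆ P j then a j else 0) := by
  classical
  have h1 : (∑ i ∈ J, a i) ^ 2 ≤ (∑ i ∈ J, ∑ j ∈ J, if P i ⊆ P j then a i * a j else 0)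
      + ∑ i ∈ J, ∑ j ∈ J, if P j ⊆ P i then a i * a j else 0 := by
    rw [sq, Finset.sum_mul_sum, ← Finset.sum_add_distrib]
    refine Finset.sum_le_sum fun i hi => ?_
    rw [← Finset.sum_add_distrib]
    refine Finset.sum_le_sum fun j hj => ?_
    have := mul_nonneg (ha i) (ha j)
    rcases hJ i hi j hj with h | h
    · rw [if_pos h]; split_ifs <;> linarith
    · rw [if_pos h]; split_ifs <;> linarith
  have h2 : (∑ i ∈ J, ∑ j ∈ J, if P j ⊆ P i then a i * a j else 0)
      = ∑ i ∈ J, ∑ j ∈ J, if P i ⊆ P j then a i * a j else 0 := by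
    rw [Finset.sum_comm]
    refine Finset.sum_congr rfl fun i _ => Finset.sum_congr rfl fun j _ => ?_
    rw [mul_comm]
  rw [h2] at h1
  have h3 : (∑ i ∈ J, ∑ j ∈ J, if P i ⊆ P j then a i * a j else 0)
      = ∑ i ∈ J, a i * ∑ j ∈ J, (if P i ⊆ P j then a j else 0) := by
    refine Finset.sum_congr rfl fun i _ => ?_
    rw [Finset.mul_sum]
    refine Finset.sum_congr rfl fun j _ => ?_
    split_ifs <;> simp
  rw [h3] at h1
  linarith

open Classical in
/-- The version for the members of `I` selected by an upward closed chain condition. -/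
lemma sq_sum_sel {ι X : Type*} (I : Finset ι) (P : ι → Set X) (a : ι → ℝ)
    (ha : ∀ i, 0 ≤ a i) (p : ι → Prop) [DecidablePred p]
    (hJ : ∀ i ∈ I, ∀ j ∈ I, p i → p j → P i ⊆ P j ∨ P j ⊆ P i) :
    (∑ i ∈ I, if p i then a i else 0) ^ 2
      ≤ 2 * ∑ i ∈ I, if p i then a i * ∑ j ∈ I, (if P i ⊆ P j then a j else 0) else 0 := by
  classical
  rw [← Finset.sum_filter, ← Finset.sum_filter]
  refine (sq_sum_chain _ P a ha ?_).trans ?_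
  · intro i hi j hj
    rw [Finset.mem_filter] at hi hj
    exact hJ i hi.1 j hj.1 hi.2 hj.2
  · refine mul_le_mul_of_nonneg_left ?_ (by norm_num)
    refine Finset.sum_le_sum fun i _ => mul_le_mul_of_nonneg_left ?_ (ha i)
    refine Finset.sum_le_sum_of_subset_of_nonneg (Finset.filter_subset _ _) fun j _ _ => ?_
    split_ifs
    exacts [ha j, le_rfl]

open Classical in
lemma core_ineq {ι X : Type*} (I : Finset ι) (P : ι → Set X) (a s : ι → ℝ) (C : ℝ) (hC : 0 < C)
    (ha : ∀ i, 0 ≤ a i) (hs : ∀ i, 0 ≤ s i)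
    (nest : ∀ i ∈ I, ∀ j ∈ I, ∀ x, x ∈ P i → x ∈ P j → P i ⊆ P j ∨ P j ⊆ P i)
    (hemp : ∀ i, P i = ∅ → s i = 0)
    (hcar : ∀ i ∈ I, (∑ j ∈ I, if P j ⊆ P i then s j else 0) ≤ C * s i) :
    ∑ i ∈ I, a i * (∑ j ∈ I, if P i ⊆ P j then a j else 0) * s i
      ≤ 2 * C * ∑ i ∈ I, a i ^ 2 * s i := by
  classical
  set S : ι → ℝ := fun i => ∑ j ∈ I, if P i ⊆ P j then a j else 0 with hS
  have hSn : ∀ i, 0 ≤ S i := fun i => Finset.sum_nonneg fun j _ => by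
    split_ifs
    exacts [ha j, le_rfl]
  change ∑ i ∈ I, a i * S i * s i ≤ _
  have hsq : ∀ g ∈ I, s g * S g ^ 2 ≤ s g * (2 * ∑ i ∈ I, if P g ⊆ P i then a i * S i else 0) := by
    intro g hg
    rcases Set.eq_empty_or_nonempty (P g) with h | ⟨x, hx⟩
    · rw [hemp g h]; simp
    · exact mul_le_mul_of_nonneg_left
        (sq_sum_sel I P a ha (fun i => P g ⊆ P i)
          fun i hi j hj h1 h2 => nest i hi j hj x (h1 hx) (h2 hx)) (hs g)
  have h2 : ∑ g ∈ I, s g * S g ^ 2 ≤ 2 * C * ∑ i ∈ I, a i * S i * s i := by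
    calc ∑ g ∈ I, s g * S g ^ 2
        ≤ ∑ g ∈ I, s g * (2 * ∑ i ∈ I, if P g ⊆ P i then a i * S i else 0) :=
          Finset.sum_le_sum hsq
      _ = ∑ g ∈ I, ∑ i ∈ I, 2 * (a i * S i) * (if P g ⊆ P i then s g else 0) := by
          refine Finset.sum_congr rfl fun g _ => ?_
          rw [Finset.mul_sum, Finset.mul_sum]
          refine Finset.sum_congr rfl fun i _ => ?_
          split_ifs <;> ring
      _ = ∑ i ∈ I, 2 * (a i * S i) * ∑ g ∈ I, (if P g ⊆ P i then s g else 0) := by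
          rw [Finset.sum_comm]
          exact Finset.sum_congr rfl fun i _ => (Finset.mul_sum _ _ _).symm
      _ ≤ ∑ i ∈ I, 2 * (a i * S i) * (C * s i) := by
          refine Finset.sum_le_sum fun i hi => mul_le_mul_of_nonneg_left (hcar i hi) ?_
          have := mul_nonneg (ha i) (hSn i)
          linarith
      _ = 2 * C * ∑ i ∈ I, a i * S i * s i := by
          rw [Finset.mul_sum]
          refine Finset.sum_congr rfl fun i _ => ?_
          ring
  have h3 : ∑ i ∈ I, a i * S i * s i
      ≤ C * ∑ i ∈ I, a i ^ 2 * s i + (1 / (4 * C)) * ∑ g ∈ I, s g * S g ^ 2 := by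
    rw [Finset.mul_sum, Finset.mul_sum, ← Finset.sum_add_distrib]
    refine Finset.sum_le_sum fun i _ => ?_
    have h : a i * S i ≤ C * a i ^ 2 + 1 / (4 * C) * S i ^ 2 := by
      have : C * a i ^ 2 + 1 / (4 * C) * S i ^ 2 - a i * S i
          = (1 / (4 * C)) * (2 * C * a i - S i) ^ 2 := by field_simp; ring
      have h' : 0 ≤ (1 / (4 * C)) * (2 * C * a i - S i) ^ 2 := by positivity
      linarith
    calc a i * S i * s i ≤ (C * a i ^ 2 + 1 / (4 * C) * S i ^ 2) * s i :=
          mul_le_mul_of_nonneg_right h (hs i)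
      _ = _ := by ring
  have h4 : (1 / (4 * C)) * ∑ g ∈ I, s g * S g ^ 2
      ≤ (1 / (4 * C)) * (2 * C * ∑ i ∈ I, a i * S i * s i) :=
    mul_le_mul_of_nonneg_left h2 (by positivity)
  have h5 : (1 / (4 * C)) * (2 * C * ∑ i ∈ I, a i * S i * s i)
      = (1 / 2) * ∑ i ∈ I, a i * S i * s i := by field_simp; ring
  rw [h5] at h4
  linarith

lemma nest_aux {n : ℕ} (t : Fin n → ℝ) (k k' : ℤ) (hk : k ≤ k') (m m' : Fin n → ℤ)
    (x : EuclideanSpace ℝ (Fin n))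
    (hx : x ∈ (⟨fun i => t i + (2:ℝ) ^ (-k) * (m i : ℝ), (2:ℝ) ^ (-k)⟩ : QCube n).pts)
    (hx' : x ∈ (⟨fun i => t i + (2:ℝ) ^ (-k') * (m' i : ℝ), (2:ℝ) ^ (-k')⟩ : QCube n).pts) :
    (⟨fun i => t i + (2:ℝ) ^ (-k') * (m' i : ℝ), (2:ℝ) ^ (-k')⟩ : QCube n).pts ⊆
    (⟨fun i => t i + (2:ℝ) ^ (-k) * (m i : ℝ), (2:ℝ) ^ (-k)⟩ : QCube n).pts := by
  obtain ⟨d, rfl⟩ := Int.le.dest hk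
  have e : (2:ℝ) ^ (-k) = (2:ℝ) ^ (-(k + (d:ℤ))) * (((2:ℤ) ^ d : ℤ) : ℝ) := by
    push_cast
    rw [← zpow_natCast, ← zpow_add₀ (by norm_num)]
    congr 1; ring
  have hq : (0:ℝ) < (2:ℝ) ^ (-(k + (d:ℤ))) := by positivity
  intro y hy i
  have hx := hx i
  have hx' := hx' i
  have hy := hy i
  simp only at hx hx' hy ⊢
  rw [e] at hx ⊢
  generalize (2:ℝ) ^ (-(k + (d:ℤ))) = q at *
  generalize (2:ℤ) ^ d = N at *
  have h1 : N * m i < m' i + 1 := by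
    have : q * ((N * m i : ℤ) : ℝ) < q * ((m' i + 1 : ℤ) : ℝ) := by push_cast; linarith
    exact_mod_cast lt_of_mul_lt_mul_left this hq.le
  have h2 : m' i < N * (m i + 1) := by
    have : q * ((m' i : ℤ) : ℝ) < q * ((N * (m i + 1) : ℤ) : ℝ) := by push_cast; linarith
    exact_mod_cast lt_of_mul_lt_mul_left this hq.le
  have h1' : ((N * m i : ℤ) : ℝ) ≤ (m' i : ℝ) := by exact_mod_cast Int.lt_add_one_iff.1 h1
  have h2' : ((m' i + 1 : ℤ) : ℝ) ≤ ((N * (m i + 1) : ℤ) : ℝ) := by exact_mod_cast h2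
  have h1q := mul_le_mul_of_nonneg_left h1' hq.le
  have h2q := mul_le_mul_of_nonneg_left h2' hq.le
  push_cast at h1q h2q
  constructor <;> linarith

lemma dyadic_nest {n : ℕ} (t : Fin n → ℝ) (Q R : QCube n) (hQ : Q ∈ dyadicGrid t)
    (hR : R ∈ dyadicGrid t) (x) (hx : x ∈ Q.pts) (hx' : x ∈ R.pts) :
    Q.pts ⊆ R.pts ∨ R.pts ⊆ Q.pts := by
  obtain ⟨k, m, rfl⟩ := hQ
  obtain ⟨k', m', rfl⟩ := hR
  rcases le_total k k' with h | h
  · exact Or.inr (nest_aux t k k' h m m' x hx hx')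
  · exact Or.inl (nest_aux t k' k h m' m x hx' hx)

lemma dyadic_countable {n : ℕ} (t : Fin n → ℝ) : (dyadicGrid t).Countable := by
  have : dyadicGrid t = Set.range (fun p : ℤ × (Fin n → ℤ) =>
      (⟨fun i => t i + (2:ℝ) ^ (-p.1) * (p.2 i : ℝ), (2:ℝ) ^ (-p.1)⟩ : QCube n)) := by
    ext Q
    constructor
    · rintro ⟨k, m, rfl⟩; exact ⟨(k, m), rfl⟩
    · rintro ⟨⟨k, m⟩, rfl⟩; exact ⟨k, m, rfl⟩
  rw [this]
  exact Set.countable_range _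

lemma pts_meas {n : ℕ} (Q : QCube n) : MeasurableSet Q.pts := by
  have : Q.pts = ⋂ i, {x | Q.a i ≤ x i ∧ x i < Q.a i + Q.l} := by
    ext x; simp [QCube.pts]
  rw [this]
  refine MeasurableSet.iInter fun i => ?_
  have hm : Measurable (fun x : EuclideanSpace ℝ (Fin n) => x i) := by fun_prop
  exact (measurableSet_le measurable_const hm).inter (measurableSet_lt hm measurable_const)

lemma pts_finite {n : ℕ} (σ : Measure (EuclideanSpace ℝ (Fin n))) [IsLocallyFiniteMeasure σ]
    (Q : QCube n) : σ Q.pts ≠ ⊤ := by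
  have hc : IsCompact ((EuclideanSpace.equiv (Fin n) ℝ).toHomeomorph ⁻¹'
      (Set.Icc Q.a (fun i => Q.a i + Q.l))) :=
    (Homeomorph.isCompact_preimage _).2 isCompact_Icc
  refine ((measure_mono ?_).trans_lt hc.measure_lt_top).ne
  intro x hx
  exact ⟨fun i => (hx i).1, fun i => (hx i).2.le⟩

/-- The finite version. -/
lemma finite_version {n : ℕ} (C₀ : ℝ) (hC₀ : 0 < C₀) (t : Fin n → ℝ)
    (σ : Measure (EuclideanSpace ℝ (Fin n))) [IsLocallyFiniteMeasure σ]
    (F𝓕 : Set (QCube n)) (hF : F𝓕 ⊆ dyadicGrid t) (hcar : IsCarleson σ C₀ F𝓕)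
    (a : QCube n → ℝ≥0) (I : Finset F𝓕) :
    (∫⁻ x, (∑ F ∈ I, (a F : ℝ≥0∞)
              * Set.indicator (F : QCube n).pts (fun _ => 1) x) ^ 2 ∂σ)
      ≤ ENNReal.ofReal (4 * C₀) * ∑ F ∈ I, (a F : ℝ≥0∞) ^ 2 * σ (F : QCube n).pts := by
  classical
  set P : F𝓕 → Set (EuclideanSpace ℝ (Fin n)) := fun F => (F : QCube n).pts with hP
  set s : F𝓕 → ℝ := fun F => (σ (P F)).toReal with hs
  set b : F𝓕 → ℝ := fun F => (a F : ℝ) with hb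
  set S : F𝓕 → ℝ := fun i => ∑ j ∈ I, if P i ⊆ P j then b j else 0 with hS
  have hb0 : ∀ i, 0 ≤ b i := fun i => NNReal.coe_nonneg _
  have hs0 : ∀ i, 0 ≤ s i := fun i => ENNReal.toReal_nonneg
  have hSn : ∀ i, 0 ≤ S i := fun i => Finset.sum_nonneg fun j _ => by
    split_ifs
    exacts [hb0 j, le_rfl]
  have hσ : ∀ i, σ (P i) = ENNReal.ofReal (s i) := fun i =>
    (ENNReal.ofReal_toReal (pts_finite σ _)).symm
  have ha : ∀ i : F𝓕, (a i : ℝ≥0∞) = ENNReal.ofReal (b i) := fun i => by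
    simp [hb]
  have nest : ∀ i j : F𝓕, ∀ x, x ∈ P i → x ∈ P j → P i ⊆ P j ∨ P j ⊆ P i :=
    fun i j x => dyadic_nest t i j (hF i.2) (hF j.2) x
  have hcar' : ∀ i ∈ I, (∑ j ∈ I, if P j ⊆ P i then s j else 0) ≤ C₀ * s i := by
    intro i _
    have h := hcar i i.2
    have h1 : (∑ j ∈ I, if P j ⊆ P i then σ (P j) else 0) ≤
        ∑' G : {G : QCube n // G ∈ F𝓕 ∧ G.pts ⊆ (i : QCube n).pts}, σ (G : QCube n).pts := by
      rw [← Finset.sum_filter]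
      let g : {j // j ∈ I.filter (fun j => P j ⊆ P i)} →
          {G : QCube n // G ∈ F𝓕 ∧ G.pts ⊆ (i : QCube n).pts} :=
        fun j => ⟨j.1.1, j.1.2, (Finset.mem_filter.1 j.2).2⟩
      have hg : Function.Injective g := by
        intro u v huv
        apply Subtype.ext; apply Subtype.ext
        exact congrArg (fun z => z.1) huv
      have := ENNReal.tsum_comp_le_tsum_of_injective hg
        (fun G : {G : QCube n // G ∈ F𝓕 ∧ G.pts ⊆ (i : QCube n).pts} => σ (G : QCube n).pts)
      rw [tsum_fintype] at this
      rw [← Finset.sum_coe_sort]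
      exact this
    have h2 := h1.trans h
    have h3 : (∑ j ∈ I, if P j ⊆ P i then σ (P j) else 0)
        = ENNReal.ofReal (∑ j ∈ I, if P j ⊆ P i then s j else 0) := by
      rw [ENNReal.ofReal_sum_of_nonneg]
      · refine Finset.sum_congr rfl fun j _ => ?_
        split_ifs
        · exact hσ j
        · simp
      · intro j _
        split_ifs
        exacts [hs0 j, le_rfl]
    rw [h3, show σ (i : QCube n).pts = ENNReal.ofReal (s i) from hσ i,
      ← ENNReal.ofReal_mul hC₀.le] at h2
    exact (ENNReal.ofReal_le_ofReal_iff (mul_nonneg hC₀.le (hs0 i))).1 h2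
  have hcore := core_ineq I P b s C₀ hC₀ hb0 hs0 (fun i _ j _ => nest i j)
    (fun i hi => by simp [hs, hi]) hcar'
  change ∑ i ∈ I, b i * S i * s i ≤ _ at hcore
  have hpt : ∀ x, (∑ F ∈ I, (a F : ℝ≥0∞) * Set.indicator (P F) (fun _ => (1:ℝ≥0∞)) x) ^ 2
      ≤ ∑ F ∈ I, ENNReal.ofReal (2 * (b F * S F)) * Set.indicator (P F) (fun _ => (1:ℝ≥0∞)) x := by
    intro x
    have h := sq_sum_sel I P b hb0 (fun i => x ∈ P i) (fun i _ j _ => nest i j x)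
    have e1 : (∑ F ∈ I, (a F : ℝ≥0∞) * Set.indicator (P F) (fun _ => (1:ℝ≥0∞)) x)
        = ENNReal.ofReal (∑ i ∈ I, if x ∈ P i then b i else 0) := by
      rw [ENNReal.ofReal_sum_of_nonneg]
      · refine Finset.sum_congr rfl fun j _ => ?_
        by_cases hx : x ∈ P j
        · simp only [hx, Set.indicator_of_mem, if_true, mul_one, ha]
        · simp [hx]
      · intro j _
        split_ifs
        exacts [hb0 j, le_rfl]
    have e2 : (∑ F ∈ I, ENNReal.ofReal (2 * (b F * S F))
          * Set.indicator (P F) (fun _ => (1:ℝ≥0∞)) x)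
        = ENNReal.ofReal (2 * ∑ i ∈ I, if x ∈ P i then b i * S i else 0) := by
      rw [Finset.mul_sum, ENNReal.ofReal_sum_of_nonneg]
      · refine Finset.sum_congr rfl fun j _ => ?_
        by_cases hx : x ∈ P j
        · simp only [hx, Set.indicator_of_mem, if_true, mul_one]
        · simp [hx]
      · intro j _
        have := mul_nonneg (hb0 j) (hSn j)
        split_ifs <;> linarith
    rw [e1, e2, ← ENNReal.ofReal_pow]
    · exact ENNReal.ofReal_le_ofReal h
    · refine Finset.sum_nonneg fun j _ => ?_
      split_ifs
      exacts [hb0 j, le_rfl]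
  refine (lintegral_mono hpt).trans ?_
  rw [lintegral_finsetSum]
  swap
  · intro F _
    exact (measurable_const.indicator (pts_meas _)).const_mul _
  have e3 : ∀ F ∈ I, ∫⁻ x, ENNReal.ofReal (2 * (b F * S F))
      * Set.indicator (P F) (fun _ => (1:ℝ≥0∞)) x ∂σ
      = ENNReal.ofReal (2 * (b F * S F * s F)) := by
    intro F _
    rw [lintegral_const_mul _ (measurable_const.indicator (pts_meas _)),
      lintegral_indicator_const (pts_meas _), one_mul, hσ, ← ENNReal.ofReal_mul]
    · congr 1; ring
    · have := mul_nonneg (hb0 F) (hSn F)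
      linarith
  rw [Finset.sum_congr rfl e3, ← ENNReal.ofReal_sum_of_nonneg]
  swap
  · intro F _
    have := mul_nonneg (mul_nonneg (hb0 F) (hSn F)) (hs0 F)
    linarith
  have e4 : ∑ F ∈ I, (a F : ℝ≥0∞) ^ 2 * σ (F : QCube n).pts
      = ENNReal.ofReal (∑ i ∈ I, b i ^ 2 * s i) := by
    rw [ENNReal.ofReal_sum_of_nonneg]
    · refine Finset.sum_congr rfl fun j _ => ?_
      rw [ENNReal.ofReal_mul (sq_nonneg _), ENNReal.ofReal_pow (hb0 j), ← hσ, ha]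
    · intro j _
      exact mul_nonneg (sq_nonneg _) (hs0 j)
  rw [e4, ← ENNReal.ofReal_mul (by linarith)]
  refine ENNReal.ofReal_le_ofReal ?_
  rw [← Finset.mul_sum]
  linarith

/-- **'Quasi'-orthogonality for Carleson families.** If `𝓕 ⊆ 𝒟` is a
`σ`-Carleson collection with constant `C₀`, then there is `C₀′ = C₀′(C₀)` such that for all
nonnegative `(α_F)_{F∈𝓕}`:
`∫ (Σ_{F∈𝓕} α_F 1_F)² dσ ≤ C₀′ Σ_{F∈𝓕} α_F² σ(F)`. -/
theorem statement12 (C₀ : ℝ) (hC₀ : 0 < C₀) :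
    ∃ C₀' : ℝ, 0 < C₀' ∧
      ∀ (n : ℕ) (t : Fin n → ℝ) (σ : Measure (EuclideanSpace ℝ (Fin n))),
        IsLocallyFiniteMeasure σ →
      ∀ F𝓕 : Set (QCube n), F𝓕 ⊆ dyadicGrid t → IsCarleson σ C₀ F𝓕 →
      ∀ a : QCube n → ℝ≥0,
        (∫⁻ x, (∑' F : F𝓕, (a F : ℝ≥0∞)
              * Set.indicator (F : QCube n).pts (fun _ => 1) x) ^ 2 ∂σ)
          ≤ ENNReal.ofReal C₀' * ∑' F : F𝓕, (a F : ℝ≥0∞) ^ 2 * σ (F : QCube n).pts := by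
  refine ⟨4 * C₀, by linarith, ?_⟩
  intro n t σ hσ F𝓕 hF hcar a
  have hcount : Countable F𝓕 := ((dyadic_countable t).mono hF).to_subtype
  have hsq : ∀ x, (∑' F : F𝓕, (a F : ℝ≥0∞)
      * Set.indicator (F : QCube n).pts (fun _ => 1) x) ^ 2
      = ⨆ I : Finset F𝓕, (∑ F ∈ I, (a F : ℝ≥0∞)
      * Set.indicator (F : QCube n).pts (fun _ => 1) x) ^ 2 := by
    intro x
    rw [ENNReal.tsum_eq_iSup_sum]
    exact Monotone.map_iSup_of_continuousAt (f := fun y : ℝ≥0∞ => y ^ 2)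
      (ENNReal.continuous_pow 2).continuousAt (pow_left_mono 2) (by simp)
  simp_rw [hsq]
  rw [lintegral_iSup_directed]
  · refine iSup_le fun I => (finite_version C₀ hC₀ t σ F𝓕 hF hcar a I).trans ?_
    gcongr
    exact ENNReal.sum_le_tsum I
  · intro I
    refine (Measurable.pow_const ?_ 2).aemeasurable
    refine Finset.measurable_sum _ fun F _ => ?_
    exact (measurable_const.indicator (pts_meas _)).const_mul _
  · refine Monotone.directed_le fun I J hIJ x => ?_
    dsimp only
    gcongr
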